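/- Let 0 < p < ∞. The polynomials are dense in the Bergman space A^p: for every holomorphic function f on 𝔻 with ∫_𝔻 |f|^p dA < ∞ and every ε > 0, there exists a polynomial q with complex coefficients such that ∫_𝔻 |f(z) − q(z)|^p dA(z) < ε. -/

import Mathlib

open MeasureTheory

open Filter Topology Metric
open scoped ENNReal NNReal

theorem ENNReal.ofReal_norm_rpow {E : Type*} [SeminormedAddGroup E] (x : E) {p : ℝ} (hp : 0 ≤ p) :
    ENNReal.ofReal (‖x‖ ^ p) = ‖x‖ₑ ^ p := by
  rw [← ENNReal.ofReal_rpow_of_nonneg (norm_nonneg x) hp, ofReal_norm]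

theorem enorm_add_rpow_le {E : Type*} [NormedAddCommGroup E] (x y : E) {p : ℝ} (hp : 0 ≤ p) :
    ‖x + y‖ₑ ^ p ≤ 2 ^ p * (‖x‖ₑ ^ p + ‖y‖ₑ ^ p) :=
  (ENNReal.rpow_le_rpow (enorm_add_le x y) hp).trans
    (ENNReal.add_rpow_le_two_rpow_mul_rpow_add_rpow _ _ hp)

/-- A form of the Riesz lemma: almost everywhere convergence together with asymptotic control of
the `p`-th moments implies convergence in `L^p`, for every exponent `p > 0`. -/
theorem tendsto_lintegral_enorm_sub_rpow_zero {α ι E : Type*} [MeasurableSpace α] {μ : Measure α}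
    [NormedAddCommGroup E] {l : Filter ι} [l.IsCountablyGenerated] {p : ℝ} (hp : 0 < p)
    {F : ι → α → E} {f : α → E} {b : ι → ℝ≥0∞}
    (hF : ∀ i, AEStronglyMeasurable (F i) μ) (hf : AEStronglyMeasurable f μ)
    (hlim : ∀ᵐ x ∂μ, Tendsto (fun i => F i x) l (𝓝 (f x)))
    (hb : ∀ i, ∫⁻ x, ‖F i x‖ₑ ^ p ∂μ ≤ b i) (hblim : Tendsto b l (𝓝 (∫⁻ x, ‖f x‖ₑ ^ p ∂μ)))
    (hfin : ∫⁻ x, ‖f x‖ₑ ^ p ∂μ ≠ ∞) :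
    Tendsto (fun i => ∫⁻ x, ‖f x - F i x‖ₑ ^ p ∂μ) l (𝓝 0) := by
  set I := ∫⁻ x, ‖f x‖ₑ ^ p ∂μ
  set C : ℝ≥0∞ := 2 ^ p
  have hC : C ≠ ∞ := ENNReal.rpow_ne_top_of_nonneg hp.le (by simp)
  refine ENNReal.tendsto_nhds_zero.2 fun ε hε => ?_
  by_contra hcon
  set J := {i | ε < ∫⁻ x, ‖f x - F i x‖ₑ ^ p ∂μ}
  have hJ : ∃ᶠ i in l, i ∈ J := fun hn =>
    hcon (hn.mono fun i hi => not_lt.1 hi)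
  set m := l ⊓ 𝓟 J
  have : m.NeBot := frequently_mem_iff_neBot.1 hJ
  have hml : m ≤ l := inf_le_left
  set g : ι → α → ℝ≥0∞ := fun i x => C * (‖f x‖ₑ ^ p + ‖F i x‖ₑ ^ p)
  set h : ι → α → ℝ≥0∞ := fun i x => ‖f x - F i x‖ₑ ^ p
  have hgh (i x) : h i x ≤ g i x := by
    have := enorm_add_rpow_le (f x) (-F i x) hp.le
    rwa [← sub_eq_add_neg, enorm_neg] at this
  have hfm : AEMeasurable (fun x => ‖f x‖ₑ ^ p) μ := hf.enorm.pow_const p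
  have hgm (i) : AEMeasurable (g i) μ := (hfm.add ((hF i).enorm.pow_const p)).const_mul C
  have hhm (i) : AEMeasurable (h i) μ := (hf.sub (hF i)).enorm.pow_const p
  have hpoint : ∀ᵐ x ∂μ, liminf (fun i => g i x - h i x) m = C * (‖f x‖ₑ ^ p + ‖f x‖ₑ ^ p) := by
    filter_upwards [hlim] with x hx
    have hx := hx.mono_left hml
    have hg : Tendsto (fun i => g i x) m (𝓝 (C * (‖f x‖ₑ ^ p + ‖f x‖ₑ ^ p))) :=
      ENNReal.Tendsto.const_mul
        (tendsto_const_nhds.add ((ENNReal.continuous_rpow_const.tendsto _).comp hx.enorm))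
        (Or.inr hC)
    have hh : Tendsto (fun i => h i x) m (𝓝 0) := by
      simpa [hp, h, Function.comp_def] using
        (ENNReal.continuous_rpow_const (y := p).tendsto _).comp (hx.const_sub (f x)).enorm
    simpa using (ENNReal.Tendsto.sub hg hh (Or.inr (by simp))).liminf_eq
  have hfatou : C * (I + I) ≤ liminf (fun i => ∫⁻ x, g i x - h i x ∂μ) m := by
    rw [← lintegral_add_left' hfm, ← lintegral_const_mul' _ _ hC, ← lintegral_congr_ae hpoint]
    exact lintegral_liminf_le' fun i => (hgm i).sub (hhm i)
  have hub : ∀ᶠ i in m, (∫⁻ x, g i x - h i x ∂μ) + ε ≤ C * (I + b i) := by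
    filter_upwards [mem_inf_of_right (mem_principal_self J)] with i hi
    calc (∫⁻ x, g i x - h i x ∂μ) + ε
        ≤ (∫⁻ x, g i x - h i x ∂μ) + ∫⁻ x, h i x ∂μ := by gcongr; exact hi.le
      _ = ∫⁻ x, g i x ∂μ := by
          rw [← lintegral_add_right' _ (hhm i)]
          exact lintegral_congr fun x => tsub_add_cancel_of_le (hgh i x)
      _ = C * (I + ∫⁻ x, ‖F i x‖ₑ ^ p ∂μ) := by
          rw [lintegral_const_mul' _ _ hC, lintegral_add_left' hfm]
      _ ≤ C * (I + b i) := by gcongr; exact hb i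
  have hCI : C * (I + I) ≠ ∞ := ENNReal.mul_ne_top hC (ENNReal.add_ne_top.2 ⟨hfin, hfin⟩)
  have hbm : Tendsto (fun i => C * (I + b i) - ε) m (𝓝 (C * (I + I) - ε)) :=
    ENNReal.Tendsto.sub
      (ENNReal.Tendsto.const_mul (tendsto_const_nhds.add (hblim.mono_left hml)) (Or.inr hC))
      tendsto_const_nhds (Or.inl hCI)
  have hεtop : ε ≠ ∞ := by
    obtain ⟨i, hi⟩ := hJ.exists
    exact ne_top_of_lt hi
  have hle : C * (I + I) ≤ C * (I + I) - ε := by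
    refine hfatou.trans ((liminf_le_liminf ?_).trans hbm.liminf_eq.le)
    filter_upwards [hub] with i hi using ENNReal.le_sub_of_add_le_right hεtop hi
  have hεle : ε ≤ C * (I + I) := by
    refine ge_of_tendsto
      (ENNReal.Tendsto.const_mul (tendsto_const_nhds.add (hblim.mono_left hml)) (Or.inr hC)) ?_
    filter_upwards [hub] with i hi using le_add_self.trans hi
  exact (ENNReal.sub_lt_self hCI (hε.trans_le hεle).ne' hε.ne').not_ge hle

theorem lintegral_comp_real_smul (g : ℂ → ℝ≥0∞) {r : ℝ} (hr : 0 < r) :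
    ∫⁻ z : ℂ, g (r • z) = ENNReal.ofReal ((r ^ 2)⁻¹) * ∫⁻ z, g z := by
  have h := (Homeomorph.smulOfNeZero (α := ℂ) r hr.ne').measurableEmbedding.lintegral_map
    (μ := volume) g
  rw [show ⇑(Homeomorph.smulOfNeZero (α := ℂ) r hr.ne') = (r • ·) from rfl,
    Measure.map_addHaar_smul _ hr.ne', lintegral_smul_measure, Complex.finrank_real_complex,
    abs_of_pos (by positivity)] at h
  simpa using h.symm

theorem setLIntegral_ball_comp_real_smul_le (g : ℂ → ℝ≥0∞) {r : ℝ} (hr : 0 < r) (hr1 : r ≤ 1) :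
    ∫⁻ z in ball (0 : ℂ) 1, g (r • z) ≤
      ENNReal.ofReal ((r ^ 2)⁻¹) * ∫⁻ z in ball (0 : ℂ) 1, g z := by
  rw [← lintegral_indicator measurableSet_ball, ← lintegral_indicator measurableSet_ball,
    ← lintegral_comp_real_smul _ hr]
  refine lintegral_mono fun z => ?_
  by_cases hz : z ∈ ball (0 : ℂ) 1
  · have hz' : r • z ∈ ball (0 : ℂ) 1 := by
      simp only [mem_ball_zero_iff, norm_smul, Real.norm_of_nonneg hr.le] at hz ⊢
      nlinarith [norm_nonneg z]
    rw [Set.indicator_of_mem hz, Set.indicator_of_mem hz']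
  · rw [Set.indicator_of_notMem hz]
    exact zero_le

/-- A holomorphic function on the unit disc is a uniform limit of polynomials on each smaller disc,
stated for the dilate of the function. -/
theorem DifferentiableOn.exists_polynomial_norm_dilate_sub_lt {f : ℂ → ℂ}
    (hf : DifferentiableOn ℂ f (ball (0 : ℂ) 1)) {r : ℝ} (hr : 0 < r) (hr1 : r < 1) {δ : ℝ}
    (hδ : 0 < δ) :
    ∃ q : Polynomial ℂ, ∀ z ∈ ball (0 : ℂ) 1, ‖f (r • z) - q.eval z‖ < δ := by
  obtain ⟨s, hrs, hs1⟩ := exists_between hr1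
  lift s to ℝ≥0 using (hr.trans hrs).le
  lift r to ℝ≥0 using hr.le
  have hps := (hf.mono (closedBall_subset_ball hs1)).hasFPowerSeriesOnBall
    (by exact_mod_cast hr.trans hrs)
  have hu := hps.tendstoUniformlyOn (r' := r) (by exact_mod_cast hrs)
  obtain ⟨n, hn⟩ := (Metric.tendstoUniformlyOn_iff.1 hu δ hδ).exists
  refine ⟨∑ k ∈ Finset.range n, Polynomial.C ((cauchyPowerSeries f 0 s).coeff k * (r : ℂ) ^ k) *
    Polynomial.X ^ k, fun z hz => ?_⟩
  have hz' : (r : ℝ) • z ∈ ball (0 : ℂ) r := by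
    simp only [mem_ball_zero_iff, norm_smul, Real.norm_of_nonneg hr.le] at hz ⊢
    nlinarith
  have h := hn _ hz'
  rw [dist_eq_norm, zero_add] at h
  convert! h using 3
  simp only [Polynomial.eval_finsetSum, FormalMultilinearSeries.partialSum,
    FormalMultilinearSeries.apply_eq_pow_smul_coeff]
  refine Finset.sum_congr rfl fun k _ => ?_
  simp [mul_pow]
  ring

/-- The polynomials are dense in the Bergman space `A^p`: every holomorphic `f` on the unit
disc with `∫_𝔻 |f|^p dA < ∞` can be approximated in `L^p(𝔻, dA)` by polynomials. -/
theorem bergman_polynomials_dense (p : ℝ) (hp : 0 < p) (f : ℂ → ℂ)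
    (hf : DifferentiableOn ℂ f (Metric.ball (0 : ℂ) 1))
    (hfLp : (∫⁻ z in Metric.ball (0 : ℂ) 1, ENNReal.ofReal (‖f z‖ ^ p)) < ⊤) :
    ∀ ε : ℝ, 0 < ε → ∃ q : Polynomial ℂ,
      (∫⁻ z in Metric.ball (0 : ℂ) 1, ENNReal.ofReal (‖f z - q.eval z‖ ^ p)) <
        ENNReal.ofReal ε := by
  intro ε hε
  simp only [ENNReal.ofReal_norm_rpow _ hp.le] at hfLp ⊢
  obtain ⟨r, -, hr, hrlim⟩ := exists_seq_strictMono_tendsto' (zero_lt_one (α := ℝ))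
  have hmaps (n) : Set.MapsTo (fun z : ℂ => r n • z) (ball 0 1) (ball 0 1) := fun z hz => by
    simp only [mem_ball_zero_iff, norm_smul, Real.norm_of_nonneg (hr n).1.le] at hz ⊢
    nlinarith [norm_nonneg z, (hr n).1, (hr n).2]
  have hdil (n) : ContinuousOn (fun z : ℂ => f (r n • z)) (ball 0 1) :=
    hf.continuousOn.comp (continuous_const_smul (r n)).continuousOn (hmaps n)
  have hconv : Tendsto (fun n => ∫⁻ z in ball (0 : ℂ) 1, ‖f z - f (r n • z)‖ₑ ^ p)
      atTop (𝓝 0) := by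
    refine tendsto_lintegral_enorm_sub_rpow_zero hp
      (b := fun n => ENNReal.ofReal ((r n ^ 2)⁻¹) * ∫⁻ z in ball (0 : ℂ) 1, ‖f z‖ₑ ^ p)
      (fun n => (hdil n).aestronglyMeasurable measurableSet_ball)
      (hf.continuousOn.aestronglyMeasurable measurableSet_ball) ?_
      (fun n => setLIntegral_ball_comp_real_smul_le (fun z => ‖f z‖ₑ ^ p) (hr n).1 (hr n).2.le)
      ?_ hfLp.ne
    · filter_upwards [ae_restrict_mem measurableSet_ball] with z hz
      have hcz : ContinuousAt f z := hf.continuousOn.continuousAt (isOpen_ball.mem_nhds hz)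
      exact hcz.tendsto.comp (by simpa using hrlim.smul_const z)
    · have h : Tendsto (fun n => ENNReal.ofReal ((r n ^ 2)⁻¹)) atTop (𝓝 1) := by
        simpa using ENNReal.tendsto_ofReal ((hrlim.pow 2).inv₀ (by simp))
      simpa using ENNReal.Tendsto.mul_const h (Or.inr hfLp.ne)
  set C : ℝ≥0∞ := 2 ^ p
  have hC : C ≠ ∞ := ENNReal.rpow_ne_top_of_nonneg hp.le (by simp)
  set V : ℝ≥0∞ := volume (ball (0 : ℂ) 1)
  have hV : V ≠ ∞ := measure_ball_lt_top.ne
  have hδlim : Tendsto (fun δ : ℝ => ENNReal.ofReal δ ^ p * V) (𝓝[>] 0) (𝓝 0) := by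
    have h : Tendsto (fun δ : ℝ => ENNReal.ofReal δ ^ p) (𝓝[>] 0) (𝓝 0) := by
      have h0 := ((ENNReal.continuous_rpow_const (y := p)).comp ENNReal.continuous_ofReal).tendsto
        (0 : ℝ)
      simpa [hp, Function.comp_def] using h0.mono_left nhdsWithin_le_nhds
    simpa using ENNReal.Tendsto.mul_const h (Or.inr hV)
  have hsum := ENNReal.Tendsto.const_mul (a := C)
    ((hconv.comp tendsto_fst).add (hδlim.comp tendsto_snd)) (Or.inr hC)
  rw [add_zero, mul_zero] at hsum
  have hpos : ∀ᶠ x : ℕ × ℝ in atTop ×ˢ 𝓝[>] 0, 0 < x.2 :=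
    tendsto_snd.eventually self_mem_nhdsWithin
  obtain ⟨⟨n, δ⟩, hlt, hδ⟩ :=
    ((hsum.eventually_lt_const (ENNReal.ofReal_pos.2 hε)).and hpos).exists
  obtain ⟨q, hq⟩ := hf.exists_polynomial_norm_dilate_sub_lt (hr n).1 (hr n).2 hδ
  refine ⟨q, lt_of_le_of_lt ?_ hlt⟩
  have hqle : ∫⁻ z in ball (0 : ℂ) 1, ‖f (r n • z) - q.eval z‖ₑ ^ p ≤ ENNReal.ofReal δ ^ p * V := by
    rw [← setLIntegral_const]
    refine setLIntegral_mono' measurableSet_ball fun z hz => ?_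
    gcongr
    rw [← ofReal_norm]
    exact ENNReal.ofReal_le_ofReal (hq z hz).le
  have hmeas : AEMeasurable (fun z => ‖f z - f (r n • z)‖ₑ ^ p)
      (volume.restrict (ball (0 : ℂ) 1)) :=
    ((hf.continuousOn.sub (hdil n)).aestronglyMeasurable measurableSet_ball).enorm.pow_const p
  calc ∫⁻ z in ball (0 : ℂ) 1, ‖f z - q.eval z‖ₑ ^ p
      ≤ ∫⁻ z in ball (0 : ℂ) 1,
          C * (‖f z - f (r n • z)‖ₑ ^ p + ‖f (r n • z) - q.eval z‖ₑ ^ p) := by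
        refine lintegral_mono fun z => ?_
        simpa using enorm_add_rpow_le (f z - f (r n • z)) (f (r n • z) - q.eval z) hp.le
    _ = C * ((∫⁻ z in ball (0 : ℂ) 1, ‖f z - f (r n • z)‖ₑ ^ p) +
          ∫⁻ z in ball (0 : ℂ) 1, ‖f (r n • z) - q.eval z‖ₑ ^ p) := by
        rw [lintegral_const_mul' _ _ hC, lintegral_add_left' hmeas]
    _ ≤ C * ((∫⁻ z in ball (0 : ℂ) 1, ‖f z - f (r n • z)‖ₑ ^ p) + ENNReal.ofReal δ ^ p * V) := by
        gcongr
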